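/- Stability lemma, first estimate (1D, isotropic scattering): assume σ_min ≤ σ_s(x) ≤ σ_max and 0 ≤ σ_a(x) ≤ σ_max on [0,1] with 0 < σ_min ≤ σ_max. There exists a constant C > 0, depending only on σ_min and σ_max (in particular independent of ε), such that for every ε ∈ (0,1], every ξ ∈ C([0,1]), every η ∈ C(Ω) with ⟨η⟩ ≡ 0, every inflow datum ζ, and every f ∈ C¹(Ω) satisfying ε v ∂_x f = σ_s(⟨f⟩ − f) − ε² σ_a f + ε² ξ(x) + ε η(x,v) on Ω with f(0,v) = ζ(0,v) for v ∈ (0,1] and f(1,v) = ζ(1,v) for v ∈ [−1,0), one has ∫₀¹∫_{−1}^{1} f² dv dx ≤ C ( ∫₀¹ ξ² dx + ∫₀¹∫_{−1}^{1} η² dv dx + ε^{−1} ( ∫₀¹ ζ(0,v)² dv + ∫_{−1}^{0} ζ(1,v)² dv ) ). -/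

import Mathlib

open MeasureTheory Set Function

/-- Velocity average `⟨h⟩(x) = (1/2)∫_{-1}^{1} h(x,v) dv`. -/
noncomputable def vavg (h : ℝ → ℝ → ℝ) (x : ℝ) : ℝ := (1/2) * ∫ v in (-1:ℝ)..1, h x v

/-- `f ∈ C¹(Ω)` with `Ω = [0,1] × [−1,1]`. -/
def C1Omega (f : ℝ → ℝ → ℝ) : Prop :=
  ContDiffOn ℝ 1 (uncurry f) (Icc (0:ℝ) 1 ×ˢ Icc (-1:ℝ) 1)

/-- `f` solves the 1D RTE `ε v ∂_x f = σ_s(⟨f⟩ − f) − ε² σ_a f + ε² G` on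
`Ω = [0,1] × [−1,1]` with inflow boundary data `φ`. -/
def SolvesRTE (ε : ℝ) (σs σa G : ℝ → ℝ) (φ f : ℝ → ℝ → ℝ) : Prop :=
  (∀ x ∈ Icc (0:ℝ) 1, ∀ v ∈ Icc (-1:ℝ) 1,
    ε * v * deriv (fun y => f y v) x
      = σs x * (vavg f x - f x v) - ε ^ 2 * σa x * f x v + ε ^ 2 * G x) ∧
  (∀ v ∈ Ioc (0:ℝ) 1, f 0 v = φ 0 v) ∧
  (∀ v ∈ Ico (-1:ℝ) 0, f 1 v = φ 1 v)

/-- The pair `(ρ, g)` solves the macro–micro system: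
`⟨v ∂_x g⟩ = −σ_a ρ + G` on `[0,1]`;
`v ∂_x(ρ + ε g) − ε⟨v ∂_x g⟩ = σ_s(⟨g⟩ − g) − ε² σ_a g` on `Ω`;
`ρ(0) + ε g(0,v) = φ(0,v)` for `v ∈ (0,1]` and `ρ(1) + ε g(1,v) = φ(1,v)` for `v ∈ [−1,0)`. -/
def SolvesMM (ε : ℝ) (σs σa G : ℝ → ℝ) (φ : ℝ → ℝ → ℝ)
    (ρ : ℝ → ℝ) (g : ℝ → ℝ → ℝ) : Prop :=
  (∀ x ∈ Icc (0:ℝ) 1,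
    ((1/2) * ∫ v in (-1:ℝ)..1, v * deriv (fun y => g y v) x) = -(σa x) * ρ x + G x) ∧
  (∀ x ∈ Icc (0:ℝ) 1, ∀ v ∈ Icc (-1:ℝ) 1,
    v * deriv (fun y => ρ y + ε * g y v) x
      - ε * ((1/2) * ∫ w in (-1:ℝ)..1, w * deriv (fun y => g y w) x)
      = σs x * (vavg g x - g x v) - ε ^ 2 * σa x * g x v) ∧
  (∀ v ∈ Ioc (0:ℝ) 1, ρ 0 + ε * g 0 v = φ 0 v) ∧
  (∀ v ∈ Ico (-1:ℝ) 0, ρ 1 + ε * g 1 v = φ 1 v)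


theorem sq_integral_le {w : ℝ → ℝ} (hw : Continuous w) {a b : ℝ} (hab : a ≤ b) :
    (∫ x in a..b, w x) ^ 2 ≤ (b - a) * ∫ x in a..b, w x ^ 2 := by
  rcases hab.eq_or_lt with rfl | hlt
  · simp
  set I := ∫ x in a..b, w x with hI
  set c := I / (b - a) with hc
  have hpos : 0 < b - a := sub_pos.2 hlt
  have h0 : 0 ≤ ∫ x in a..b, (w x - c) ^ 2 :=
    intervalIntegral.integral_nonneg hab fun x _ => sq_nonneg _
  have h1 : ∫ x in a..b, (w x - c) ^ 2
      = (∫ x in a..b, w x ^ 2) - 2 * c * I + (b - a) * c ^ 2 := by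
    have : ∀ x, (w x - c) ^ 2 = w x ^ 2 - (2 * c) * w x + c ^ 2 := fun x => by ring
    simp_rw [this]
    rw [intervalIntegral.integral_add, intervalIntegral.integral_sub,
      intervalIntegral.integral_const_mul, intervalIntegral.integral_const, smul_eq_mul]
    all_goals exact Continuous.intervalIntegrable (by fun_prop) _ _
  have hcI : c * (b - a) = I := div_mul_cancel₀ _ hpos.ne'
  have h2 : (b - a) * c ^ 2 = c * I := by rw [← hcI]; ring
  have h3 : c * I ≤ ∫ x in a..b, w x ^ 2 := by linarith
  calc I ^ 2 = (b - a) * (c * I) := by rw [← hcI]; ring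
    _ ≤ _ := mul_le_mul_of_nonneg_left h3 hpos.le

theorem intervalIntegral_swap_of_continuous {F : ℝ → ℝ → ℝ} (hF : Continuous (uncurry F))
    (a b c d : ℝ) :
    ∫ x in a..b, ∫ y in c..d, F x y = ∫ y in c..d, ∫ x in a..b, F x y :=
  intervalIntegral_intervalIntegral_swap
    ((hF.continuousOn.integrableOn_compact (isCompact_uIcc.prod isCompact_uIcc)).mono_set
      (prod_mono uIoc_subset_uIcc uIoc_subset_uIcc))

/-- The right-hand side of the transport equation at a fixed position, as a function of `v`. -/
noncomputable def transportSource (ε s t ξ : ℝ) (e u : ℝ → ℝ) (v : ℝ) : ℝ :=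
  s * ((1/2) * (∫ w in (-1:ℝ)..1, u w) - u v) - ε ^ 2 * t * u v + ε ^ 2 * ξ + ε * e v

section Slice

variable {u e : ℝ → ℝ} {ρ : ℝ}

theorem integral_sub_mean_eq_zero (hu : Continuous u)
    (hρ : ρ = (1/2) * ∫ w in (-1:ℝ)..1, u w) : ∫ v in (-1:ℝ)..1, (u v - ρ) = 0 := by
  rw [intervalIntegral.integral_sub (hu.intervalIntegrable _ _) (by simp),
    intervalIntegral.integral_const, smul_eq_mul, hρ]
  ring

theorem integral_sq_eq_fluctuation_add_mean (hu : Continuous u)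
    (hρ : ρ = (1/2) * ∫ w in (-1:ℝ)..1, u w) :
    ∫ v in (-1:ℝ)..1, u v ^ 2 = (∫ v in (-1:ℝ)..1, (u v - ρ) ^ 2) + 2 * ρ ^ 2 := by
  have h := integral_sub_mean_eq_zero hu hρ
  have hd : ∀ v, u v ^ 2 = (u v - ρ) ^ 2 + 2 * ρ * (u v - ρ) + ρ ^ 2 := fun v => by ring
  simp_rw [hd]
  rw [intervalIntegral.integral_add, intervalIntegral.integral_add,
    intervalIntegral.integral_const_mul, intervalIntegral.integral_const, smul_eq_mul, h]
  · ring
  all_goals exact Continuous.intervalIntegrable (by fun_prop) _ _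

theorem integral_mul_transportSource_le {ε s t ξ σ : ℝ} (hu : Continuous u) (he : Continuous e)
    (hρ : ρ = (1/2) * ∫ w in (-1:ℝ)..1, u w) (he0 : ∫ v in (-1:ℝ)..1, e v = 0)
    (hσ : 0 < σ) (hs : σ ≤ s) (ht : 0 ≤ t) :
    ∫ v in (-1:ℝ)..1, u v * transportSource ε s t ξ e u v
      ≤ -(σ / 2) * (∫ v in (-1:ℝ)..1, (u v - ρ) ^ 2)
        + ε ^ 2 / (2 * σ) * (∫ v in (-1:ℝ)..1, e v ^ 2) + 2 * ε ^ 2 * (ξ * ρ) := by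
  have h := integral_sub_mean_eq_zero hu hρ
  have key : ∫ v in (-1:ℝ)..1, u v * transportSource ε s t ξ e u v
      ≤ ∫ v in (-1:ℝ)..1, (-(σ / 2) * (u v - ρ) ^ 2 + ε ^ 2 / (2 * σ) * e v ^ 2
        + (ε ^ 2 * ξ - s * ρ) * (u v - ρ) + ε * ρ * e v + ε ^ 2 * (ξ * ρ)) := by
    apply intervalIntegral.integral_mono_on (by norm_num)
      (Continuous.intervalIntegrable (by unfold transportSource; fun_prop) _ _)
      (Continuous.intervalIntegrable (by fun_prop) _ _)
    intro v _
    unfold transportSource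
    rw [← hρ]
    have h1 : ε * e v * (u v - ρ) ≤ σ / 2 * (u v - ρ) ^ 2 + ε ^ 2 / (2 * σ) * e v ^ 2 := by
      have h2 : σ / 2 * (u v - ρ) ^ 2 + ε ^ 2 / (2 * σ) * e v ^ 2 - ε * e v * (u v - ρ)
          = (σ * (u v - ρ) - ε * e v) ^ 2 / (2 * σ) := by field_simp; ring
      have h3 : 0 ≤ (σ * (u v - ρ) - ε * e v) ^ 2 / (2 * σ) := by positivity
      linarith
    have h4 : 0 ≤ (s - σ) * (u v - ρ) ^ 2 := mul_nonneg (by linarith) (sq_nonneg _)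
    have h5 : 0 ≤ ε ^ 2 * t * u v ^ 2 := by positivity
    nlinarith
  refine key.trans_eq ?_
  rw [intervalIntegral.integral_add, intervalIntegral.integral_add, intervalIntegral.integral_add,
    intervalIntegral.integral_add, intervalIntegral.integral_const_mul,
    intervalIntegral.integral_const_mul, intervalIntegral.integral_const_mul,
    intervalIntegral.integral_const_mul, intervalIntegral.integral_const, smul_eq_mul, h, he0]
  · ring
  all_goals exact Continuous.intervalIntegrable (by fun_prop) _ _

theorem sq_integral_velocity_mul_transportSource_le {ε s t ξ M : ℝ} (hu : Continuous u)
    (he : Continuous e) (hρ : ρ = (1/2) * ∫ w in (-1:ℝ)..1, u w) (hs0 : 0 ≤ s) (hs : s ≤ M)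
    (ht0 : 0 ≤ t) (ht : t ≤ M) (hε0 : 0 ≤ ε) (hε : ε ≤ 1) :
    (∫ v in (-1:ℝ)..1, v * transportSource ε s t ξ e u v) ^ 2
      ≤ 16 * M ^ 2 * (∫ v in (-1:ℝ)..1, (u v - ρ) ^ 2)
        + 4 * ε ^ 2 * (∫ v in (-1:ℝ)..1, e v ^ 2) := by
  have hε2 : ε ^ 2 ≤ 1 := pow_le_one₀ hε0 hε
  set k := s + ε ^ 2 * t with hk
  have hk0 : 0 ≤ k := by positivity
  have hkM : k ^ 2 ≤ 4 * M ^ 2 := by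
    have : k ≤ 2 * M := by nlinarith
    nlinarith
  have h1 : ∫ v in (-1:ℝ)..1, v * transportSource ε s t ξ e u v
      = ∫ v in (-1:ℝ)..1, v * (ε * e v - k * (u v - ρ)) := by
    have hd : ∀ v, v * transportSource ε s t ξ e u v
        = v * (ε * e v - k * (u v - ρ)) + (ε ^ 2 * ξ - ε ^ 2 * t * ρ) * v := fun v => by
      unfold transportSource; rw [← hρ]; ring
    simp_rw [hd]
    rw [intervalIntegral.integral_add, intervalIntegral.integral_const_mul, integral_id]
    · norm_num
    all_goals exact Continuous.intervalIntegrable (by fun_prop) _ _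
  rw [h1]
  refine (sq_integral_le (by fun_prop) (by norm_num)).trans ?_
  have h2 : ∫ v in (-1:ℝ)..1, (v * (ε * e v - k * (u v - ρ))) ^ 2
      ≤ ∫ v in (-1:ℝ)..1, (8 * M ^ 2 * (u v - ρ) ^ 2 + 2 * ε ^ 2 * e v ^ 2) := by
    apply intervalIntegral.integral_mono_on (by norm_num)
      (Continuous.intervalIntegrable (by fun_prop) _ _)
      (Continuous.intervalIntegrable (by fun_prop) _ _)
    intro v hv
    have hv2 : v ^ 2 ≤ 1 := by nlinarith [hv.1, hv.2]
    calc (v * (ε * e v - k * (u v - ρ))) ^ 2 = v ^ 2 * (ε * e v - k * (u v - ρ)) ^ 2 := by ring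
      _ ≤ 1 * (ε * e v - k * (u v - ρ)) ^ 2 := by gcongr
      _ ≤ 2 * (k ^ 2 * (u v - ρ) ^ 2) + 2 * ε ^ 2 * e v ^ 2 := by
        nlinarith [sq_nonneg (ε * e v + k * (u v - ρ))]
      _ ≤ 2 * (4 * M ^ 2 * (u v - ρ) ^ 2) + 2 * ε ^ 2 * e v ^ 2 := by gcongr
      _ = _ := by ring
  rw [intervalIntegral.integral_add, intervalIntegral.integral_const_mul,
    intervalIntegral.integral_const_mul] at h2
  · linarith
  all_goals exact Continuous.intervalIntegrable (by fun_prop) _ _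

/-- The mean is recovered from the second velocity moment up to the fluctuation. -/
theorem integral_velocity_sq_mul (hu : Continuous u) :
    ∫ v in (-1:ℝ)..1, v ^ 2 * u v
      = 2 / 3 * ρ + ∫ v in (-1:ℝ)..1, v ^ 2 * (u v - ρ) := by
  have hd : ∀ v, v ^ 2 * u v = ρ * v ^ 2 + v ^ 2 * (u v - ρ) := fun v => by ring
  simp_rw [hd]
  rw [intervalIntegral.integral_add, intervalIntegral.integral_const_mul, integral_pow]
  · norm_num; ring
  all_goals exact Continuous.intervalIntegrable (by fun_prop) _ _

theorem sq_integral_velocity_sq_mul_le {w m : ℝ → ℝ} (hw : Continuous w) (hm : Continuous m)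
    (h : ∀ v ∈ Icc (-1:ℝ) 1, v ^ 4 ≤ m v) :
    (∫ v in (-1:ℝ)..1, v ^ 2 * w v) ^ 2 ≤ 2 * ∫ v in (-1:ℝ)..1, m v * w v ^ 2 := by
  refine (sq_integral_le (by fun_prop) (by norm_num)).trans ?_
  have : ∫ v in (-1:ℝ)..1, (v ^ 2 * w v) ^ 2 ≤ ∫ v in (-1:ℝ)..1, m v * w v ^ 2 := by
    apply intervalIntegral.integral_mono_on (by norm_num)
      (Continuous.intervalIntegrable (by fun_prop) _ _)
      (Continuous.intervalIntegrable (by fun_prop) _ _)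
    intro v hv
    calc (v ^ 2 * w v) ^ 2 = v ^ 4 * w v ^ 2 := by ring
      _ ≤ _ := by gcongr; exact h v hv
  linarith

/-- The incoming part of the boundary flux controls the defect between the absolute and the
signed flux. -/
theorem flux_ge {a b : ℝ → ℝ} (ha : Continuous a) (hb : Continuous b) :
    (∫ v in (-1:ℝ)..1, |v| * (a v ^ 2 + b v ^ 2))
        - 2 * ((∫ v in (0:ℝ)..1, a v ^ 2) + ∫ v in (-1:ℝ)..0, b v ^ 2)
      ≤ ∫ v in (-1:ℝ)..1, v * (b v ^ 2 - a v ^ 2) := by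
  have hp : ∫ v in (0:ℝ)..1, (|v| * (a v ^ 2 + b v ^ 2) - 2 * a v ^ 2)
      ≤ ∫ v in (0:ℝ)..1, v * (b v ^ 2 - a v ^ 2) := by
    apply intervalIntegral.integral_mono_on (by norm_num)
      (Continuous.intervalIntegrable (by fun_prop) _ _)
      (Continuous.intervalIntegrable (by fun_prop) _ _)
    intro v hv
    rw [abs_of_nonneg hv.1]
    nlinarith [mul_nonneg (sub_nonneg.2 hv.2) (sq_nonneg (a v))]
  have hn : ∫ v in (-1:ℝ)..0, (|v| * (a v ^ 2 + b v ^ 2) - 2 * b v ^ 2)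
      ≤ ∫ v in (-1:ℝ)..0, v * (b v ^ 2 - a v ^ 2) := by
    apply intervalIntegral.integral_mono_on (by norm_num)
      (Continuous.intervalIntegrable (by fun_prop) _ _)
      (Continuous.intervalIntegrable (by fun_prop) _ _)
    intro v hv
    rw [abs_of_nonpos hv.2]
    nlinarith [mul_nonneg (by linarith [hv.1] : 0 ≤ 1 + v) (sq_nonneg (b v))]
  rw [intervalIntegral.integral_sub, intervalIntegral.integral_const_mul] at hp hn
  · rw [← intervalIntegral.integral_add_adjacent_intervals (a := -1) (b := 0) (c := 1)
        (f := fun v => |v| * (a v ^ 2 + b v ^ 2)),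
      ← intervalIntegral.integral_add_adjacent_intervals (a := -1) (b := 0) (c := 1)
        (f := fun v => v * (b v ^ 2 - a v ^ 2))]
    · linarith
    all_goals exact Continuous.intervalIntegrable (by fun_prop) _ _
  all_goals exact Continuous.intervalIntegrable (by fun_prop) _ _

end Slice

/-- The constant of the stability estimate. -/
noncomputable def densityConst (σ M : ℝ) : ℝ :=
  9 / 4 * (12 + (12 + 96 * M ^ 2) / σ + 24 * σ)

theorem densityConst_pos {σ M : ℝ} (hσ : 0 < σ) : 0 < densityConst σ M := by
  unfold densityConst; positivity

/-- Absorption argument combining the energy bound and the moment bound. -/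
theorem absorb_energy_moment {σ M ε P G X E Z B S : ℝ} (hσ : 0 < σ) (hε0 : 0 < ε) (hε : ε ≤ 1)
    (hG : 0 ≤ G) (hX : 0 ≤ X) (hE : 0 ≤ E) (hZ : 0 ≤ Z) (hB : 0 ≤ B)
    (henergy : ε / 2 * (B - 2 * Z) ≤ -(σ / 2) * G + ε ^ 2 / (2 * σ) * E + 2 * ε ^ 2 * S)
    (hS : ∀ δ > 0, 2 * S ≤ δ * P + X / δ)
    (hmoment : 4 / 9 * P ≤ 6 * B + 6 * G + 3 * (16 * M ^ 2 * G + 4 * ε ^ 2 * E) / ε ^ 2) :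
    G + 2 * P ≤ (4 * densityConst σ M + 4 / σ) * (1 + 2 * densityConst σ M + 1 / σ)
      * (X + E + ε⁻¹ * Z) := by
  set A := densityConst σ M with hA
  have hA0 : 0 < A := densityConst_pos hσ
  obtain ⟨g, hg⟩ : ∃ g, G = ε ^ 2 * g := ⟨G / ε ^ 2, by field_simp⟩
  obtain ⟨z, hz⟩ : ∃ z, Z = ε * z := ⟨Z / ε, by field_simp⟩
  have hg0 : 0 ≤ g := by
    by_contra! h
    nlinarith [mul_pos (pow_pos hε0 2) (neg_pos.2 h)]
  have hz0 : 0 ≤ z := by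
    by_contra! h
    nlinarith [mul_pos hε0 (neg_pos.2 h)]
  have hz' : ε⁻¹ * Z = z := by rw [hz]; field_simp
  have hGg : G ≤ g := by
    rw [hg]; exact mul_le_of_le_one_left hg0 (pow_le_one₀ hε0.le hε)
  set W := z + E / (2 * σ) + 2 * S with hW
  have hWeq : ε ^ 2 * W = ε * Z + ε ^ 2 / (2 * σ) * E + 2 * ε ^ 2 * S := by
    rw [hW, hz]; ring
  have h1 : ε / 2 * B + ε ^ 2 * (σ / 2 * g) ≤ ε ^ 2 * W := by
    rw [hWeq]; rw [hg] at henergy; linarith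
  have h2 : B / 2 + ε * (σ / 2 * g) ≤ ε * W := by
    refine le_of_mul_le_mul_left ?_ hε0
    linarith
  have hgW : σ / 2 * g ≤ W := by
    refine le_of_mul_le_mul_left ?_ hε0
    linarith
  have hW0 : 0 ≤ W := le_trans (by positivity) hgW
  have hBW : B ≤ 2 * W := by
    have := mul_le_of_le_one_left hW0 hε
    have : 0 ≤ ε * (σ / 2 * g) := by positivity
    linarith
  have hgW' : g ≤ 2 / σ * W := by
    rw [div_mul_eq_mul_div, le_div_iff₀ hσ]; linarith
  have hPA : P ≤ A * (W + E / (2 * σ)) := by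
    have h3 : 3 * (16 * M ^ 2 * G + 4 * ε ^ 2 * E) / ε ^ 2 = 48 * M ^ 2 * g + 12 * E := by
      rw [hg]; field_simp; ring
    rw [h3] at hmoment
    have h4 : (6 + 48 * M ^ 2) * g ≤ (6 + 48 * M ^ 2) * (2 / σ * W) := by gcongr
    have h5 : P ≤ 9 / 4 * (12 * W + (6 + 48 * M ^ 2) * (2 / σ * W) + 12 * E) := by linarith
    refine h5.trans ?_
    have h6 : A * (W + E / (2 * σ)) - 9 / 4 * (12 * W + (6 + 48 * M ^ 2) * (2 / σ * W) + 12 * E)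
        = 9 / 4 * (24 * σ * W + (12 + (12 + 96 * M ^ 2) / σ) * (E / (2 * σ))) := by
      rw [hA, densityConst]; field_simp; ring
    have h7 : 0 ≤ 9 / 4 * (24 * σ * W + (12 + (12 + 96 * M ^ 2) / σ) * (E / (2 * σ))) := by
      positivity
    linarith
  have hS' : 2 * S ≤ P / (2 * A) + 2 * A * X := by
    have := hS (1 / (2 * A)) (by positivity)
    have h8 : X / (1 / (2 * A)) = 2 * A * X := by field_simp
    rw [h8] at this
    linarith [show 1 / (2 * A) * P = P / (2 * A) by ring]
  set V := z + E / σ + 2 * A * X with hV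
  have hWV : W + E / (2 * σ) ≤ V + P / (2 * A) := by
    have : E / σ = E / (2 * σ) + E / (2 * σ) := by field_simp; ring
    rw [hV, hW, this]; linarith
  have hPV : P ≤ 2 * A * V := by
    have h9 : A * (W + E / (2 * σ)) ≤ A * (V + P / (2 * A)) := by gcongr
    have h10 : A * (V + P / (2 * A)) = A * V + P / 2 := by field_simp
    linarith
  have hWV' : W ≤ 2 * V := by
    have h11 : P / (2 * A) ≤ V := by rw [div_le_iff₀ (by positivity)]; linarith
    have : 0 ≤ E / (2 * σ) := by positivity
    linarith
  have hGV : G ≤ 4 / σ * V := by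
    calc G ≤ 2 / σ * W := hGg.trans hgW'
      _ ≤ 2 / σ * (2 * V) := by gcongr
      _ = _ := by ring
  have hfin : V ≤ (1 + 2 * A + 1 / σ) * (X + E + z) := by
    have : (1 + 2 * A + 1 / σ) * (X + E + z) - V
        = (1 + 1 / σ) * X + (1 + 2 * A) * E + (2 * A + 1 / σ) * z := by
      rw [hV]; field_simp; ring
    have : 0 ≤ (1 + 1 / σ) * X + (1 + 2 * A) * E + (2 * A + 1 / σ) * z := by positivity
    linarith
  rw [hz']
  calc G + 2 * P ≤ (4 * A + 4 / σ) * V := by linarith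
    _ ≤ _ := by rw [mul_assoc]; gcongr

theorem stability_of_continuous {σ M ε : ℝ} (hσ : 0 < σ) (hε0 : 0 < ε) (hε : ε ≤ 1)
    {σs σa ξ : ℝ → ℝ} {η f : ℝ → ℝ → ℝ} (hσs : Continuous σs) (hσa : Continuous σa)
    (hξ : Continuous ξ) (hη : Continuous (uncurry η)) (hf : Continuous (uncurry f))
    (hsb : ∀ x ∈ Icc (0:ℝ) 1, σ ≤ σs x ∧ σs x ≤ M)
    (hab : ∀ x ∈ Icc (0:ℝ) 1, 0 ≤ σa x ∧ σa x ≤ M)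
    (hη0 : ∀ x ∈ Icc (0:ℝ) 1, ∫ v in (-1:ℝ)..1, η x v = 0)
    (htransport : ∀ x ∈ Icc (0:ℝ) 1, ∀ v ∈ Icc (-1:ℝ) 1,
      ∫ y in (0:ℝ)..x, transportSource ε (σs y) (σa y) (ξ y) (η y) (f y) v
        = ε * (v * (f x v - f 0 v)))
    (henergy : ∀ v ∈ Icc (-1:ℝ) 1,
      ∫ y in (0:ℝ)..1, f y v * transportSource ε (σs y) (σa y) (ξ y) (η y) (f y) v
        = ε / 2 * (v * (f 1 v ^ 2 - f 0 v ^ 2))) :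
    (∫ x in (0:ℝ)..1, ∫ v in (-1:ℝ)..1, f x v ^ 2)
      ≤ (4 * densityConst σ M + 4 / σ) * (1 + 2 * densityConst σ M + 1 / σ)
        * ((∫ x in (0:ℝ)..1, ξ x ^ 2) + (∫ x in (0:ℝ)..1, ∫ v in (-1:ℝ)..1, η x v ^ 2)
          + ε⁻¹ * ((∫ v in (0:ℝ)..1, f 0 v ^ 2) + ∫ v in (-1:ℝ)..0, f 1 v ^ 2)) := by
  set ρ : ℝ → ℝ := fun x => (1/2) * ∫ w in (-1:ℝ)..1, f x w with hρ
  have hρc : Continuous ρ := by fun_prop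
  set H : ℝ → ℝ → ℝ := fun x v => transportSource ε (σs x) (σa x) (ξ x) (η x) (f x) v with hH
  have hHc : Continuous (uncurry H) := by
    have : uncurry H = fun p : ℝ × ℝ => σs p.1 * (ρ p.1 - f p.1 p.2) - ε ^ 2 * σa p.1 * f p.1 p.2
        + ε ^ 2 * ξ p.1 + ε * η p.1 p.2 := rfl
    rw [this]; fun_prop
  have hf0 : ∀ x, Continuous (f x) := fun x => by fun_prop
  have hη0c : ∀ x, Continuous (η x) := fun x => by fun_prop
  set a : ℝ → ℝ := fun x => ∫ v in (-1:ℝ)..1, (f x v - ρ x) ^ 2 with ha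
  set b : ℝ → ℝ := fun x => ∫ v in (-1:ℝ)..1, η x v ^ 2 with hb
  have hac : Continuous a := by fun_prop
  have hbc : Continuous b := by fun_prop
  have ha0 : ∀ x, 0 ≤ a x := fun x =>
    intervalIntegral.integral_nonneg (by norm_num) fun _ _ => sq_nonneg _
  have hb0 : ∀ x, 0 ≤ b x := fun x =>
    intervalIntegral.integral_nonneg (by norm_num) fun _ _ => sq_nonneg _
  set B := ∫ v in (-1:ℝ)..1, |v| * (f 0 v ^ 2 + f 1 v ^ 2) with hB
  set Z := (∫ v in (0:ℝ)..1, f 0 v ^ 2) + ∫ v in (-1:ℝ)..0, f 1 v ^ 2 with hZ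
  have hsplit : (∫ x in (0:ℝ)..1, ∫ v in (-1:ℝ)..1, f x v ^ 2)
      = (∫ x in (0:ℝ)..1, a x) + 2 * ∫ x in (0:ℝ)..1, ρ x ^ 2 := by
    rw [← intervalIntegral.integral_const_mul, ← intervalIntegral.integral_add]
    · exact intervalIntegral.integral_congr fun x _ =>
        integral_sq_eq_fluctuation_add_mean (hf0 x) rfl
    all_goals exact Continuous.intervalIntegrable (by fun_prop) _ _
  have hen : ε / 2 * (B - 2 * Z) ≤ -(σ / 2) * (∫ x in (0:ℝ)..1, a x)
      + ε ^ 2 / (2 * σ) * (∫ x in (0:ℝ)..1, b x) + 2 * ε ^ 2 * ∫ x in (0:ℝ)..1, ξ x * ρ x := by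
    have h1 : ε / 2 * ∫ v in (-1:ℝ)..1, v * (f 1 v ^ 2 - f 0 v ^ 2)
        = ∫ x in (0:ℝ)..1, ∫ v in (-1:ℝ)..1, f x v * H x v := by
      rw [intervalIntegral_swap_of_continuous (by fun_prop), ← intervalIntegral.integral_const_mul]
      refine intervalIntegral.integral_congr fun v hv => ?_
      rw [uIcc_of_le (by norm_num)] at hv
      exact (henergy v hv).symm
    have h2 : ∫ x in (0:ℝ)..1, ∫ v in (-1:ℝ)..1, f x v * H x v
        ≤ ∫ x in (0:ℝ)..1, (-(σ / 2) * a x + ε ^ 2 / (2 * σ) * b x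
          + 2 * ε ^ 2 * (ξ x * ρ x)) := by
      apply intervalIntegral.integral_mono_on (by norm_num)
        (Continuous.intervalIntegrable (by fun_prop) _ _)
        (Continuous.intervalIntegrable (by fun_prop) _ _)
      intro x hx
      exact integral_mul_transportSource_le (hf0 x) (hη0c x) rfl (hη0 x hx) hσ (hsb x hx).1
        (hab x hx).1
    rw [intervalIntegral.integral_add, intervalIntegral.integral_add,
      intervalIntegral.integral_const_mul, intervalIntegral.integral_const_mul,
      intervalIntegral.integral_const_mul, ← h1] at h2
    · exact (mul_le_mul_of_nonneg_left (flux_ge (hf0 0) (hf0 1)) (by positivity)).trans h2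
    all_goals exact Continuous.intervalIntegrable (by fun_prop) _ _
  have hS : ∀ δ > 0, 2 * (∫ x in (0:ℝ)..1, ξ x * ρ x)
      ≤ δ * (∫ x in (0:ℝ)..1, ρ x ^ 2) + (∫ x in (0:ℝ)..1, ξ x ^ 2) / δ := by
    intro δ hδ
    rw [div_eq_inv_mul, ← intervalIntegral.integral_const_mul, ← intervalIntegral.integral_const_mul,
      ← intervalIntegral.integral_const_mul, ← intervalIntegral.integral_add]
    · apply intervalIntegral.integral_mono_on (by norm_num)
        (Continuous.intervalIntegrable (by fun_prop) _ _)
        (Continuous.intervalIntegrable (by fun_prop) _ _)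
      intro x _
      have h1 : δ * ρ x ^ 2 + δ⁻¹ * ξ x ^ 2 - 2 * (ξ x * ρ x) = δ⁻¹ * (δ * ρ x - ξ x) ^ 2 := by
        field_simp; ring
      have h2 : 0 ≤ δ⁻¹ * (δ * ρ x - ξ x) ^ 2 := by positivity
      linarith
    all_goals exact Continuous.intervalIntegrable (by fun_prop) _ _
  set Q := 16 * M ^ 2 * (∫ x in (0:ℝ)..1, a x) + 4 * ε ^ 2 * ∫ x in (0:ℝ)..1, b x with hQ
  have hmom : ∀ x ∈ Icc (0:ℝ) 1, 4 / 9 * ρ x ^ 2 ≤ 6 * B + 6 * a x + 3 * Q / ε ^ 2 := by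
    intro x hx
    set m : ℝ → ℝ := fun y => ∫ v in (-1:ℝ)..1, v * H y v with hm
    have hmc : Continuous m := by fun_prop
    have h1 : ∫ y in (0:ℝ)..x, m y
        = ε * ((∫ v in (-1:ℝ)..1, v ^ 2 * f x v) - ∫ v in (-1:ℝ)..1, v ^ 2 * f 0 v) := by
      rw [intervalIntegral_swap_of_continuous (by fun_prop), ← intervalIntegral.integral_sub,
        ← intervalIntegral.integral_const_mul]
      · refine intervalIntegral.integral_congr fun v hv => ?_
        rw [uIcc_of_le (by norm_num)] at hv
        have := htransport x hx v hv
        simp only [intervalIntegral.integral_const_mul]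
        rw [this]; ring
      all_goals exact Continuous.intervalIntegrable (by fun_prop) _ _
    have h2 : (∫ y in (0:ℝ)..x, m y) ^ 2 ≤ Q := by
      have hm2 : 0 ≤ ∫ y in (0:ℝ)..x, m y ^ 2 :=
        intervalIntegral.integral_nonneg hx.1 fun _ _ => sq_nonneg _
      calc (∫ y in (0:ℝ)..x, m y) ^ 2 ≤ (x - 0) * ∫ y in (0:ℝ)..x, m y ^ 2 :=
            sq_integral_le hmc hx.1
        _ ≤ ∫ y in (0:ℝ)..x, m y ^ 2 := mul_le_of_le_one_left hm2 (by linarith [hx.2])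
        _ ≤ ∫ y in (0:ℝ)..1, m y ^ 2 := by
          apply intervalIntegral.integral_mono_interval le_rfl hx.1 hx.2
          · exact Filter.Eventually.of_forall fun _ => sq_nonneg _
          · exact Continuous.intervalIntegrable (by fun_prop) _ _
        _ ≤ ∫ y in (0:ℝ)..1, (16 * M ^ 2 * a y + 4 * ε ^ 2 * b y) := by
          apply intervalIntegral.integral_mono_on (by norm_num)
            (Continuous.intervalIntegrable (by fun_prop) _ _)
            (Continuous.intervalIntegrable (by fun_prop) _ _)
          intro y hy
          exact sq_integral_velocity_mul_transportSource_le (hf0 y) (hη0c y) rfl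
            (hσ.le.trans (hsb y hy).1) (hsb y hy).2 (hab y hy).1 (hab y hy).2 hε0.le hε
        _ = Q := by
          rw [intervalIntegral.integral_add, intervalIntegral.integral_const_mul,
            intervalIntegral.integral_const_mul]
          all_goals exact Continuous.intervalIntegrable (by fun_prop) _ _
    have h3 : (∫ v in (-1:ℝ)..1, v ^ 2 * f 0 v) ^ 2 ≤ 2 * B := by
      refine (sq_integral_velocity_sq_mul_le (hf0 0) continuous_abs ?_).trans ?_
      · intro v hv
        have hv1 : |v| ≤ 1 := abs_le.2 hv
        calc v ^ 4 = |v| ^ 4 := by rw [← abs_pow, abs_of_nonneg (by positivity)]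
          _ ≤ |v| := pow_le_of_le_one (abs_nonneg v) hv1 (by norm_num)
      · have : ∫ v in (-1:ℝ)..1, |v| * f 0 v ^ 2 ≤ B := by
          apply intervalIntegral.integral_mono_on (by norm_num)
            (Continuous.intervalIntegrable (by fun_prop) _ _)
            (Continuous.intervalIntegrable (by fun_prop) _ _)
          intro v _
          have := sq_nonneg (f 1 v)
          gcongr
          linarith
        linarith
    have h4 : (∫ v in (-1:ℝ)..1, v ^ 2 * (f x v - ρ x)) ^ 2 ≤ 2 * a x := by
      have := sq_integral_velocity_sq_mul_le (w := fun v => f x v - ρ x) (m := fun _ => 1)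
        (by fun_prop) continuous_const (fun v hv => by
          have : v ^ 2 ≤ 1 := by nlinarith [hv.1, hv.2]
          nlinarith [sq_nonneg v])
      simpa using this
    rw [integral_velocity_sq_mul (ρ := ρ x) (hf0 x)] at h1
    set k := ∫ v in (-1:ℝ)..1, v ^ 2 * f 0 v
    set j := ∫ v in (-1:ℝ)..1, v ^ 2 * (f x v - ρ x)
    set I := ∫ y in (0:ℝ)..x, m y
    have h5 : 2 / 3 * ρ x = I / ε + k - j := by rw [h1]; field_simp; ring
    have h6 : (I / ε) ^ 2 ≤ Q / ε ^ 2 := by rw [div_pow]; gcongr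
    calc 4 / 9 * ρ x ^ 2 = (2 / 3 * ρ x) ^ 2 := by ring
      _ = (I / ε + k - j) ^ 2 := by rw [h5]
      _ ≤ 3 * ((I / ε) ^ 2 + k ^ 2 + j ^ 2) := by
        nlinarith [sq_nonneg (I / ε - k), sq_nonneg (I / ε + j), sq_nonneg (k + j)]
      _ ≤ 3 * (Q / ε ^ 2 + 2 * B + 2 * a x) := by gcongr
      _ = _ := by ring
  have hmoment : 4 / 9 * (∫ x in (0:ℝ)..1, ρ x ^ 2)
      ≤ 6 * B + 6 * (∫ x in (0:ℝ)..1, a x) + 3 * Q / ε ^ 2 := by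
    have h1 : ∫ x in (0:ℝ)..1, 4 / 9 * ρ x ^ 2
        ≤ ∫ x in (0:ℝ)..1, (6 * a x + (6 * B + 3 * Q / ε ^ 2)) := by
      apply intervalIntegral.integral_mono_on (by norm_num)
        (Continuous.intervalIntegrable (by fun_prop) _ _)
        (Continuous.intervalIntegrable (by fun_prop) _ _)
      intro x hx
      linarith [hmom x hx]
    rw [intervalIntegral.integral_add, intervalIntegral.integral_const_mul,
      intervalIntegral.integral_const_mul, intervalIntegral.integral_const, smul_eq_mul] at h1
    · linarith
    all_goals exact Continuous.intervalIntegrable (by fun_prop) _ _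
  rw [hsplit]
  have h01 : (0:ℝ) ≤ 1 := zero_le_one
  refine absorb_energy_moment hσ hε0 hε
    (intervalIntegral.integral_nonneg h01 fun x _ => ha0 x)
    (intervalIntegral.integral_nonneg h01 fun _ _ => sq_nonneg _)
    (intervalIntegral.integral_nonneg h01 fun x _ => hb0 x)
    (add_nonneg (intervalIntegral.integral_nonneg h01 fun _ _ => sq_nonneg _)
      (intervalIntegral.integral_nonneg (by norm_num) fun _ _ => sq_nonneg _))
    (intervalIntegral.integral_nonneg (by norm_num) fun _ _ => by positivity) hen hS hmoment

/-- The retraction of the real line onto `[a, b]`. -/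
def clamp (a b x : ℝ) : ℝ := max a (min b x)

theorem continuous_clamp (a b : ℝ) : Continuous (clamp a b) := by unfold clamp; fun_prop

theorem clamp_mem {a b : ℝ} (hab : a ≤ b) (x : ℝ) : clamp a b x ∈ Icc a b :=
  ⟨le_max_left _ _, max_le hab (min_le_left _ _)⟩

theorem clamp_of_mem {a b x : ℝ} (hx : x ∈ Icc a b) : clamp a b x = x := by
  rw [clamp, min_eq_right hx.2, max_eq_right hx.1]

theorem ContinuousOn.comp_clamp {g : ℝ → ℝ} {a b : ℝ} (hab : a ≤ b)
    (hg : ContinuousOn g (Icc a b)) : Continuous fun x => g (clamp a b x) :=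
  hg.comp_continuous (continuous_clamp a b) (clamp_mem hab)

theorem ContinuousOn.comp_clamp₂ {g : ℝ → ℝ → ℝ} {a b c d : ℝ} (hab : a ≤ b) (hcd : c ≤ d)
    (hg : ContinuousOn (uncurry g) (Icc a b ×ˢ Icc c d)) :
    Continuous (uncurry fun x v => g (clamp a b x) (clamp c d v)) :=
  hg.comp_continuous (f := fun p : ℝ × ℝ => (clamp a b p.1, clamp c d p.2))
    (((continuous_clamp a b).comp continuous_fst).prodMk
      ((continuous_clamp c d).comp continuous_snd))
    fun p => ⟨clamp_mem hab p.1, clamp_mem hcd p.2⟩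

theorem integral_comp_clamp {g : ℝ → ℝ} {a b c d : ℝ} (hcd : c ≤ d) (h : Icc c d ⊆ Icc a b) :
    ∫ x in c..d, g (clamp a b x) = ∫ x in c..d, g x :=
  intervalIntegral.integral_congr fun x hx => by
    rw [uIcc_of_le hcd] at hx
    simp only [clamp_of_mem (h hx)]

theorem C1Omega.hasDerivAt {f : ℝ → ℝ → ℝ} (hf : C1Omega f) {x v : ℝ} (hx : x ∈ Ioo (0:ℝ) 1)
    (hv : v ∈ Icc (-1:ℝ) 1) : HasDerivAt (fun y => f y v) (deriv (fun y => f y v) x) x := by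
  have h1 : DifferentiableOn ℝ (fun y : ℝ => uncurry f (y, v)) (Icc 0 1) :=
    (hf.differentiableOn one_ne_zero).comp (f := fun y : ℝ => (y, v))
      (by fun_prop) fun y hy => ⟨hy, hv⟩
  exact (h1.differentiableAt (Icc_mem_nhds hx.1 hx.2)).hasDerivAt

/-- Stability lemma, first estimate (1D, isotropic scattering): there is a constant
`C > 0` depending only on `σ_min, σ_max` such that for every `ε ∈ (0,1]` and every `C¹`
solution `f` of the perturbed RTE with data `ξ, η` (with `⟨η⟩ ≡ 0`) and inflow datum `ζ`,
`‖f‖²_{L²(Ω)} ≤ C(‖ξ‖² + ‖η‖² + ε⁻¹ ‖ζ‖²_{L²(Γ₋)})`. -/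
theorem stability_first_estimate (σmin σmax : ℝ) (hσmin : 0 < σmin) (hσ : σmin ≤ σmax) :
    ∃ C > 0, ∀ ε ∈ Ioc (0:ℝ) 1, ∀ σs σa ξ : ℝ → ℝ, ∀ η ζ f : ℝ → ℝ → ℝ,
      (∀ x ∈ Icc (0:ℝ) 1, σmin ≤ σs x ∧ σs x ≤ σmax) →
      (∀ x ∈ Icc (0:ℝ) 1, 0 ≤ σa x ∧ σa x ≤ σmax) →
      ContinuousOn σs (Icc 0 1) → ContinuousOn σa (Icc 0 1) →
      ContinuousOn ξ (Icc 0 1) →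
      ContinuousOn (uncurry η) (Icc (0:ℝ) 1 ×ˢ Icc (-1:ℝ) 1) →
      (∀ x ∈ Icc (0:ℝ) 1, vavg η x = 0) →
      C1Omega f →
      (∀ x ∈ Icc (0:ℝ) 1, ∀ v ∈ Icc (-1:ℝ) 1,
        ε * v * deriv (fun y => f y v) x
          = σs x * (vavg f x - f x v) - ε ^ 2 * σa x * f x v
            + ε ^ 2 * ξ x + ε * η x v) →
      (∀ v ∈ Ioc (0:ℝ) 1, f 0 v = ζ 0 v) →
      (∀ v ∈ Ico (-1:ℝ) 0, f 1 v = ζ 1 v) →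
      (∫ x in (0:ℝ)..1, ∫ v in (-1:ℝ)..1, (f x v) ^ 2)
        ≤ C * ((∫ x in (0:ℝ)..1, (ξ x) ^ 2)
            + (∫ x in (0:ℝ)..1, ∫ v in (-1:ℝ)..1, (η x v) ^ 2)
            + ε⁻¹ * ((∫ v in (0:ℝ)..1, (ζ 0 v) ^ 2)
                + ∫ v in (-1:ℝ)..0, (ζ 1 v) ^ 2)) := by
  refine ⟨(4 * densityConst σmin σmax + 4 / σmin) * (1 + 2 * densityConst σmin σmax + 1 / σmin),
    ?_, ?_⟩
  · have := densityConst_pos (M := σmax) hσmin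
    positivity
  intro ε hε σs σa ξ η ζ f hsb hab hσs hσa hξ hη hη0 hf hRTE hζ0 hζ1
  have h01 : (0:ℝ) ≤ 1 := zero_le_one
  have h11 : (-1:ℝ) ≤ 1 := by norm_num
  have hfc : ContinuousOn (uncurry f) (Icc (0:ℝ) 1 ×ˢ Icc (-1:ℝ) 1) := hf.continuousOn
  set σs' : ℝ → ℝ := fun x => σs (clamp 0 1 x) with hσs'
  set σa' : ℝ → ℝ := fun x => σa (clamp 0 1 x) with hσa'
  set ξ' : ℝ → ℝ := fun x => ξ (clamp 0 1 x) with hξ'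
  set η' : ℝ → ℝ → ℝ := fun x v => η (clamp 0 1 x) (clamp (-1) 1 v) with hη'
  set f' : ℝ → ℝ → ℝ := fun x v => f (clamp 0 1 x) (clamp (-1) 1 v) with hf'
  have cσs : Continuous σs' := hσs.comp_clamp h01
  have cσa : Continuous σa' := hσa.comp_clamp h01
  have cξ : Continuous ξ' := hξ.comp_clamp h01
  have cη : Continuous (uncurry η') := hη.comp_clamp₂ h01 h11
  have cf : Continuous (uncurry f') := hfc.comp_clamp₂ h01 h11
  have hf'_eq : ∀ x ∈ Icc (0:ℝ) 1, ∀ v ∈ Icc (-1:ℝ) 1, f' x v = f x v := fun x hx v hv => by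
    simp only [hf', clamp_of_mem hx, clamp_of_mem hv]
  have hη'_eq : ∀ x ∈ Icc (0:ℝ) 1, ∀ v ∈ Icc (-1:ℝ) 1, η' x v = η x v := fun x hx v hv => by
    simp only [hη', clamp_of_mem hx, clamp_of_mem hv]
  set H : ℝ → ℝ → ℝ := fun x v => transportSource ε (σs' x) (σa' x) (ξ' x) (η' x) (f' x) v with hH
  have hHc : ∀ v, Continuous fun x => H x v := by
    intro v
    simp only [hH, transportSource]
    fun_prop
  have hderiv : ∀ v ∈ Icc (-1:ℝ) 1, ∀ x ∈ Ioo (0:ℝ) 1,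
      ∃ D, HasDerivAt (fun y => f' y v) D x ∧ ε * v * D = H x v := by
    intro v hv x hx
    have hx' := Ioo_subset_Icc_self hx
    refine ⟨_, (hf.hasDerivAt hx hv).congr_of_eventuallyEq ?_, ?_⟩
    · filter_upwards [Icc_mem_nhds hx.1 hx.2] with y hy using hf'_eq y hy v hv
    · have hmean : ∫ w in (-1:ℝ)..1, f' x w = ∫ w in (-1:ℝ)..1, f x w := by
        refine intervalIntegral.integral_congr fun w hw => ?_
        rw [uIcc_of_le h11] at hw
        exact hf'_eq x hx' w hw
      rw [hRTE x hx' v hv]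
      simp only [hH, transportSource, hmean, hf'_eq x hx' v hv, hη'_eq x hx' v hv, vavg,
        hσs', hσa', hξ', clamp_of_mem hx']
  have key := stability_of_continuous (M := σmax) hσmin hε.1 hε.2 cσs cσa cξ cη cf
    (fun x _ => hsb _ (clamp_mem h01 x)) (fun x _ => hab _ (clamp_mem h01 x))
    (fun x hx => ?_) (fun x hx v hv => ?_) (fun v hv => ?_)
  · have ef : ∫ x in (0:ℝ)..1, ∫ v in (-1:ℝ)..1, f' x v ^ 2
        = ∫ x in (0:ℝ)..1, ∫ v in (-1:ℝ)..1, f x v ^ 2 := by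
      refine intervalIntegral.integral_congr fun x hx => ?_
      refine intervalIntegral.integral_congr fun v hv => ?_
      rw [uIcc_of_le h01] at hx
      rw [uIcc_of_le h11] at hv
      simp only [hf'_eq x hx v hv]
    have eη : ∫ x in (0:ℝ)..1, ∫ v in (-1:ℝ)..1, η' x v ^ 2
        = ∫ x in (0:ℝ)..1, ∫ v in (-1:ℝ)..1, η x v ^ 2 := by
      refine intervalIntegral.integral_congr fun x hx => ?_
      refine intervalIntegral.integral_congr fun v hv => ?_
      rw [uIcc_of_le h01] at hx
      rw [uIcc_of_le h11] at hv
      simp only [hη'_eq x hx v hv]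
    have eξ : ∫ x in (0:ℝ)..1, ξ' x ^ 2 = ∫ x in (0:ℝ)..1, ξ x ^ 2 :=
      integral_comp_clamp (g := fun x => ξ x ^ 2) h01 subset_rfl
    have e0 : ∫ v in (0:ℝ)..1, f' 0 v ^ 2 = ∫ v in (0:ℝ)..1, ζ 0 v ^ 2 := by
      refine intervalIntegral.integral_congr_Ioo_of_le (by norm_num) fun v hv => ?_
      simp only [hf'_eq 0 (by simp) v ⟨by linarith [hv.1], hv.2.le⟩, hζ0 v ⟨hv.1, hv.2.le⟩]
    have e1 : ∫ v in (-1:ℝ)..0, f' 1 v ^ 2 = ∫ v in (-1:ℝ)..0, ζ 1 v ^ 2 := by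
      refine intervalIntegral.integral_congr_Ioo_of_le (by norm_num) fun v hv => ?_
      simp only [hf'_eq 1 (by simp) v ⟨hv.1.le, by linarith [hv.2]⟩, hζ1 v ⟨hv.1.le, hv.2⟩]
    rwa [ef, eη, eξ, e0, e1] at key
  · have h1 : ∫ v in (-1:ℝ)..1, η' x v = ∫ v in (-1:ℝ)..1, η x v := by
      refine intervalIntegral.integral_congr fun v hv => ?_
      rw [uIcc_of_le h11] at hv
      exact hη'_eq x hx v hv
    have h2 := hη0 x hx
    rw [vavg] at h2
    linarith
  · have := intervalIntegral.integral_eq_sub_of_hasDerivAt_of_le (f := fun y => ε * v * f' y v)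
      (f' := fun y => H y v) hx.1 (Continuous.continuousOn (by fun_prop)) (fun y hy => ?_)
      ((hHc v).intervalIntegrable _ _)
    · exact this.trans (by ring)
    · obtain ⟨D, hD, hDH⟩ := hderiv v hv y ⟨hy.1, hy.2.trans_le hx.2⟩
      rw [← hDH]
      exact hD.const_mul _
  · have := intervalIntegral.integral_eq_sub_of_hasDerivAt_of_le
      (f := fun y => ε / 2 * v * f' y v ^ 2) (f' := fun y => f' y v * H y v) h01
      (Continuous.continuousOn (by fun_prop)) (fun y hy => ?_)
      (Continuous.intervalIntegrable (by have := hHc v; fun_prop) _ _)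
    · exact this.trans (by ring)
    · obtain ⟨D, hD, hDH⟩ := hderiv v hv y hy
      rw [← hDH]
      refine ((hD.fun_pow 2).const_mul (ε / 2 * v)).congr_deriv ?_
      push_cast
      ring
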